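/- arXiv:2504.15264 — 3 statements merged into one kernel-verified Lean document; each statement's English description precedes it below -/
import Mathlib

section
/- Let k be a positive integer and L ⊆ {0,1,...,k-1}. Let s be the largest integer such that there exists a strictly decreasing sequence ℓ_1 > ℓ_2 > ... > ℓ_s of elements of L satisfying the convexity condition 2ℓ_i ≤ ℓ_{i-1} + ℓ_{i+1} for all i ∈ {2,...,s-1}. Then any family 𝓕 of k-element subsets of {1,...,n}, in which |F_1 ∩ F_2| ∈ L for all distinct F_1, F_2 ∈ 𝓕, has cardinality at most C(k) · n^s for some constant C(k) depending only on k. -/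
/-- There is a strictly decreasing convex sequence `ℓ₁ > ℓ₂ > ⋯ > ℓ_s` of elements of `L`. -/
def ConvexSeqIn (L : Finset ℕ) (s : ℕ) : Prop :=
  ∃ ℓ : ℕ → ℕ,
    (∀ i ∈ Finset.Icc 1 s, ℓ i ∈ L) ∧
    (∀ i ∈ Finset.Icc 1 (s - 1), ℓ (i + 1) < ℓ i) ∧
    (∀ i, 2 ≤ i → i ≤ s - 1 → 2 * ℓ i ≤ ℓ (i - 1) + ℓ (i + 1))

open Finset in
/-- A family closed under intersection, all of whose member sizes lie in `L`, that omits the whole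
set but covers every set with at most `s` elements, produces a convex sequence of length `s + 1`. -/
theorem convexSeqIn_of_inter_closed {κ : Type*} [Fintype κ] [DecidableEq κ]
    (𝓙 : Finset (Finset κ)) (L : Finset ℕ) (s : ℕ) (huniv : univ ∉ 𝓙)
    (hinter : ∀ A ∈ 𝓙, ∀ B ∈ 𝓙, A ∩ B ∈ 𝓙) (hL : ∀ A ∈ 𝓙, A.card ∈ L)
    (hcover : ∀ T : Finset κ, T.card ≤ s → ∃ A ∈ 𝓙, T ⊆ A) : ConvexSeqIn L (s + 1) := by
  classical
  obtain ⟨T, hT, hTmin⟩ := exists_min_image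
    (univ.filter fun T : Finset κ => ∀ A ∈ 𝓙, ¬ T ⊆ A) card
    ⟨univ, by
      simp only [mem_filter, mem_univ, true_and, univ_subset_iff]
      rintro A hA rfl
      exact huniv hA⟩
  simp only [mem_filter, mem_univ, true_and] at hT hTmin
  have hTs : s + 1 ≤ T.card := by
    by_contra! h
    obtain ⟨A, hA, hTA⟩ := hcover T (by omega)
    exact hT A hA hTA
  have hB : ∀ t, ∃ B, t ∈ T → B ∈ 𝓙 ∧ T.erase t ⊆ B := by
    intro t
    by_cases ht : t ∈ T
    · by_contra! h
      have := hTmin (T.erase t) fun A hA => (h A).2 hA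
      have := card_erase_lt_of_mem ht
      omega
    · exact ⟨∅, fun h => absurd h ht⟩
  choose B hB using hB
  have hBself : ∀ t ∈ T, t ∉ B t := by
    intro t ht htB
    refine hT _ (hB t ht).1 fun x hx => ?_
    by_cases hxt : x = t
    · exact hxt ▸ htB
    · exact (hB t ht).2 (mem_erase.2 ⟨hxt, hx⟩)
  let h : Finset κ → Finset κ := fun U => univ.filter fun x => ∀ t ∈ U, x ∈ B t
  have mem_h : ∀ U x, x ∈ h U ↔ ∀ t ∈ U, x ∈ B t := by simp [h]
  have h_mem : ∀ U : Finset κ, U.Nonempty → U ⊆ T → h U ∈ 𝓙 := by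
    intro U hU
    induction hU using Finset.Nonempty.cons_induction with
    | singleton a =>
      intro ha
      have : h {a} = B a := by ext; simp [mem_h]
      rw [this]
      exact (hB a (ha (mem_singleton_self a))).1
    | cons a U ha hU ih =>
      intro hsub
      have : h (cons a U ha) = B a ∩ h U := by ext; simp [mem_h]
      rw [this]
      exact hinter _ (hB a (hsub (mem_cons_self a U))).1 _
        (ih fun x hx => hsub (mem_cons_of_mem hx))
  have h_lt : ∀ U ⊆ T, ∀ u ∈ U, (h U).card < (h (U.erase u)).card := by
    intro U hU u hu
    refine card_lt_card ((ssubset_iff_of_subset ?_).2 ⟨u, ?_, ?_⟩)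
    · intro x hx
      rw [mem_h] at hx ⊢
      exact fun t ht => hx t (mem_of_mem_erase ht)
    · rw [mem_h]
      intro t ht
      exact (hB t (hU (mem_of_mem_erase ht))).2 (mem_erase.2 ⟨(ne_of_mem_erase ht).symm, hU hu⟩)
    · rw [mem_h]
      exact fun hx => hBself u (hU hu) (hx u hu)
  have h_super : ∀ U : Finset κ, ∀ u v, u ≠ v →
      (h (U.erase u)).card + (h (U.erase v)).card ≤
        (h ((U.erase u).erase v)).card + (h U).card := by
    intro U u v huv
    rw [← card_union_add_card_inter]
    refine add_le_add (card_le_card fun x hx => ?_) (card_le_card fun x hx => ?_)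
    · simp only [mem_union, mem_h, mem_erase] at hx ⊢
      exact fun t ht => hx.elim (fun h => h t ⟨ht.2.1, ht.2.2⟩) fun h => h t ⟨ht.1, ht.2.2⟩
    · simp only [mem_inter, mem_h, mem_erase] at hx ⊢
      intro t ht
      by_cases htu : t = u
      · exact hx.2 t ⟨htu ▸ huv, ht⟩
      · exact hx.1 t ⟨htu, ht⟩
  have hstep : ∀ U : Finset κ, ∃ V, U.Nonempty →
      ∃ u ∈ U, V = U.erase u ∧ ∀ v ∈ U, (h (U.erase u)).card ≤ (h (U.erase v)).card := by
    intro U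
    by_cases hU : U.Nonempty
    · obtain ⟨u, hu, hmin⟩ := exists_min_image U (fun u => (h (U.erase u)).card) hU
      exact ⟨U.erase u, fun _ => ⟨u, hu, rfl, hmin⟩⟩
    · exact ⟨∅, fun h => absurd h hU⟩
  choose next hnext using hstep
  let U : ℕ → Finset κ := fun j => next^[j] T
  have U_succ : ∀ j, U (j + 1) = next (U j) := fun j => Function.iterate_succ_apply' next j T
  have U_spec : ∀ j ≤ s, U j ⊆ T ∧ (U j).card + j = T.card := by
    intro j
    induction j with
    | zero => intro _; simp [U]
    | succ j ih =>
      intro hj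
      obtain ⟨hsub, hcard⟩ := ih (by omega)
      obtain ⟨u, hu, hV, -⟩ := hnext (U j) (card_pos.1 (by omega))
      rw [U_succ, hV]
      have := card_erase_add_one hu
      exact ⟨(erase_subset _ _).trans hsub, by omega⟩
  have U_ne : ∀ j ≤ s, (U j).Nonempty := by
    intro j hj
    have := (U_spec j hj).2
    exact card_pos.1 (by omega)
  have U_mono : ∀ j < s, (h (U j)).card < (h (U (j + 1))).card := by
    intro j hj
    obtain ⟨u, hu, hV, -⟩ := hnext (U j) (U_ne j hj.le)
    rw [U_succ, hV]
    exact h_lt _ (U_spec j hj.le).1 u hu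
  have U_convex : ∀ j, j + 2 ≤ s →
      2 * (h (U (j + 1))).card ≤ (h (U (j + 2))).card + (h (U j)).card := by
    intro j hj
    obtain ⟨u, hu, hV, hmin⟩ := hnext (U j) (U_ne j (by omega))
    obtain ⟨v, hv, hW, -⟩ := hnext (U (j + 1)) (U_ne (j + 1) (by omega))
    rw [U_succ (j + 1), hW]
    rw [U_succ, hV] at hv ⊢
    have := h_super (U j) u v (ne_of_mem_erase hv).symm
    have := hmin v (mem_of_mem_erase hv)
    omega
  refine ⟨fun i => (h (U (s + 1 - i))).card, fun i hi => ?_, fun i hi => ?_, fun i hi hi' => ?_⟩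
  · rw [mem_Icc] at hi
    exact hL _ (h_mem _ (U_ne _ (by omega)) (U_spec _ (by omega)).1)
  · rw [mem_Icc] at hi
    have := U_mono (s + 1 - (i + 1)) (by omega)
    rwa [show s + 1 - (i + 1) + 1 = s + 1 - i by omega] at this
  · have := U_convex (s + 1 - (i + 1)) (by omega)
    rwa [show s + 1 - (i + 1) + 1 = s + 1 - i by omega,
      show s + 1 - (i + 1) + 2 = s + 1 - (i - 1) by omega] at this

theorem Finset.exists_injOn_fin {α : Type*} {k : ℕ} (hk : 1 ≤ k) (X : Finset α)
    (hX : X.card ≤ k) : ∃ f : α → Fin k, Set.InjOn f X := by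
  classical
  obtain ⟨e⟩ := Function.Embedding.nonempty_of_card_le (α := X) (β := Fin k) (by simpa using hX)
  refine ⟨fun x => if h : x ∈ X then e ⟨x, h⟩ else ⟨0, hk⟩, fun x hx y hy hxy => ?_⟩
  have hx' : x ∈ X := hx
  have hy' : y ∈ X := hy
  simpa [hx', hy'] using hxy

open Finset in
open Classical in
/-- Some `k`-colouring makes at least a `k⁻ᵏ` proportion of a `k`-uniform family rainbow. -/
theorem exists_rainbow_subfamily {α : Type*} {k : ℕ} (hk : 1 ≤ k) (V : Finset α)
    (𝓕 : Finset (Finset α)) (h𝓕 : ∀ F ∈ 𝓕, F ⊆ V ∧ F.card = k) :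
    ∃ χ : α → Fin k,
      𝓕.card ≤ k ^ k * (𝓕.filter fun F : Finset α => Set.InjOn χ F).card := by
  let ext : (V → Fin k) → α → Fin k := fun c x => if h : x ∈ V then c ⟨x, h⟩ else ⟨0, hk⟩
  have hext : ∀ c (x : V), ext c x = c x := fun c x => by simp [ext]
  have hgood : ∀ F ∈ 𝓕, Fintype.card (V → Fin k) ≤
      k ^ k * (univ.filter fun c => Set.InjOn (ext c) F).card := by
    intro F hF
    obtain ⟨hFV, hFk⟩ := h𝓕 F hF
    obtain ⟨e, he⟩ := F.exists_injOn_fin hk hFk.le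
    have hcard : k ^ k = (univ : Finset (F → Fin k)).card := by simp [hFk]
    rw [hcard, ← card_product, ← card_univ]
    refine card_le_card_of_injOn
      (fun c => (fun x : F => c ⟨x, hFV x.2⟩, fun v : V => if v.1 ∈ F then e v else c v)) ?_ ?_
    · intro c _
      simp only [mem_coe, mem_product, mem_univ, true_and, mem_filter]
      intro x hx y hy hxy
      have hx' : x ∈ F := hx
      have hy' : y ∈ F := hy
      simp only [ext, hFV hx', hFV hy', hx', hy', dif_pos, if_true] at hxy
      exact he hx hy hxy
    · intro c _ d _ hcd
      obtain ⟨h₁, h₂⟩ := Prod.mk.inj hcd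
      funext v
      by_cases hv : v.1 ∈ F
      · exact congrFun h₁ ⟨v.1, hv⟩
      · simpa [hv] using congrFun h₂ v
  by_contra! hcon
  have hne : (univ : Finset (V → Fin k)).Nonempty := ⟨fun _ => ⟨0, hk⟩, mem_univ _⟩
  have hlt := sum_lt_sum_of_nonempty hne fun c _ => hcon (ext c)
  have hle := sum_le_sum hgood
  rw [← mul_sum] at hlt hle
  have hswap : ∑ c, (𝓕.filter fun F : Finset α => Set.InjOn (ext c) F).card =
      ∑ F ∈ 𝓕, (univ.filter fun c => Set.InjOn (ext c) F).card := by
    simp only [card_filter]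
    exact sum_comm
  rw [hswap] at hlt
  simp only [sum_const, card_univ, smul_eq_mul] at hlt hle
  rw [mul_comm] at hle
  omega

/-- `B` is the exact trace of members of `𝓖` containing it on any set of at most `r` points:
a robust form of being the kernel of a large sunflower in `𝓖`. -/
def IsRobustKernel {α : Type*} [DecidableEq α] (r : ℕ) (𝓖 : Finset (Finset α))
    (B : Finset α) : Prop :=
  ∀ X : Finset α, X.card ≤ r → ∃ G ∈ 𝓖, B ⊆ G ∧ G ∩ X ⊆ B

open Finset in
theorem inter_eq_filter_of_image_eq {α κ : Type*} [DecidableEq α] [DecidableEq κ] {χ : α → κ}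
    {F G : Finset α} {A : Finset κ} (hF : Set.InjOn χ F) (h : (F ∩ G).image χ = A) :
    F ∩ G = F.filter fun x => χ x ∈ A := by
  subst h
  ext x
  simp only [mem_filter, mem_image, mem_inter]
  constructor
  · exact fun hx => ⟨hx.1, x, hx, rfl⟩
  · rintro ⟨hx, y, hy, hyx⟩
    rwa [← hF hy.1 hx hyx]

open Finset in
/-- A large subfamily in which a given type of intersection no longer occurs. -/
theorem exists_subfamily_avoiding {α : Type*} [DecidableEq α] {k : ℕ} (hk : 1 ≤ k)
    {χ : α → Fin k} (𝓘 : Finset (Finset (Fin k))) (𝓕 : Finset (Finset α))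
    (hχ : ∀ F ∈ 𝓕, Set.InjOn χ F)
    (hno : ∀ F ∈ 𝓕, ∃ A ∈ 𝓘, ¬ IsRobustKernel k 𝓕 (F.filter fun x => χ x ∈ A)) (hne : 𝓕.Nonempty) :
    ∃ A ∈ 𝓘, ∃ 𝓖 ⊆ 𝓕, 𝓕.card ≤ 2 ^ k * k * 𝓖.card ∧
      ∀ F ∈ 𝓖, ∀ G ∈ 𝓖, (F ∩ G).image χ ≠ A := by
  have hX : ∀ B : Finset α, ∃ X : Finset α, ¬ IsRobustKernel k 𝓕 B →
      X.card ≤ k ∧ ∀ G ∈ 𝓕, B ⊆ G → ∃ y ∈ G ∩ X, y ∉ B := by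
    intro B
    by_cases h : IsRobustKernel k 𝓕 B
    · exact ⟨∅, fun h' => absurd h h'⟩
    · unfold IsRobustKernel at h
      push Not at h
      obtain ⟨X, hXk, hX⟩ := h
      exact ⟨X, fun _ => ⟨hXk, fun G hG hBG => not_subset.1 (hX G hG hBG)⟩⟩
  choose X hX using hX
  have he : ∀ B, ∃ e : α → Fin k, ¬ IsRobustKernel k 𝓕 B → Set.InjOn e (X B) := by
    intro B
    by_cases h : IsRobustKernel k 𝓕 B
    · exact ⟨fun _ => ⟨0, hk⟩, fun h' => absurd h h'⟩
    · obtain ⟨e, he⟩ := (X B).exists_injOn_fin hk (hX B h).1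
      exact ⟨e, fun _ => he⟩
  choose e he using he
  have hdata : ∀ F, ∃ p : Finset (Fin k) × Fin k, F ∈ 𝓕 → p.1 ∈ 𝓘 ∧
      ¬ IsRobustKernel k 𝓕 (F.filter fun x => χ x ∈ p.1) ∧
      ∃ y ∈ F ∩ X (F.filter fun x => χ x ∈ p.1), y ∉ F.filter (fun x => χ x ∈ p.1) ∧
        e (F.filter fun x => χ x ∈ p.1) y = p.2 := by
    intro F
    by_cases hF : F ∈ 𝓕
    · obtain ⟨A, hA, hAF⟩ := hno F hF
      obtain ⟨y, hy, hyA⟩ := (hX _ hAF).2 F hF (filter_subset _ _)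
      exact ⟨(A, e (F.filter fun x => χ x ∈ A) y), fun _ => ⟨hA, hAF, y, hy, hyA, rfl⟩⟩
    · exact ⟨(∅, ⟨0, hk⟩), fun h => absurd h hF⟩
  choose p hp using hdata
  obtain ⟨q, -, hq⟩ : ∃ q ∈ (univ : Finset (Finset (Fin k) × Fin k)),
      𝓕.card ≤ 2 ^ k * k * (𝓕.filter fun F => p F = q).card := by
    by_contra! hcon
    have hlt := sum_lt_sum_of_nonempty ⟨(∅, ⟨0, hk⟩), mem_univ _⟩ hcon
    rw [← mul_sum, ← card_eq_sum_card_fiberwise fun _ _ => mem_coe.2 (mem_univ _)] at hlt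
    simp at hlt
  have hpos : (𝓕.filter fun F => p F = q).Nonempty := by
    rw [← card_pos]
    have := hne.card_pos
    exact Nat.pos_of_ne_zero fun h => by rw [h, mul_zero] at hq; omega
  obtain ⟨F₀, hF₀⟩ := hpos
  rw [mem_filter] at hF₀
  refine ⟨q.1, hF₀.2 ▸ (hp F₀ hF₀.1).1, _, filter_subset _ _, hq, fun F hF G hG hFG => ?_⟩
  rw [mem_filter] at hF hG
  have hFeq := inter_eq_filter_of_image_eq (hχ F hF.1) hFG
  have hGeq := inter_eq_filter_of_image_eq (hχ G hG.1) (inter_comm F G ▸ hFG)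
  obtain ⟨-, hker, y, hy, hyB, hye⟩ := hp F hF.1
  obtain ⟨-, -, z, hz, hzB, hze⟩ := hp G hG.1
  rw [hF.2, ← hFeq] at hker hy hyB hye
  rw [hG.2, ← hGeq, inter_comm G F] at hz hzB hze
  rw [mem_inter] at hy hz
  have hyz : y = z := he _ hker hy.2 hz.2 (hye.trans hze.symm)
  exact hyB (mem_inter.2 ⟨hy.1, hyz ▸ hz.1⟩)

open Finset in
/-- A form of Füredi's intersection semilattice lemma for rainbow families. -/
theorem exists_homogeneous_subfamily {α : Type*} [DecidableEq α] {k : ℕ} (hk : 1 ≤ k)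
    {χ : α → Fin k} (𝓘 : Finset (Finset (Fin k))) (𝓕 : Finset (Finset α)) (hne : 𝓕.Nonempty)
    (hχ : ∀ F ∈ 𝓕, Set.InjOn χ F)
    (h𝓘 : ∀ F ∈ 𝓕, ∀ G ∈ 𝓕, F ≠ G → (F ∩ G).image χ ∈ 𝓘) :
    ∃ 𝓙 ⊆ 𝓘, ∃ 𝓖 ⊆ 𝓕, 𝓕.card ≤ (2 ^ k * k) ^ 𝓘.card * 𝓖.card ∧
      (∀ F ∈ 𝓖, ∀ G ∈ 𝓖, F ≠ G → (F ∩ G).image χ ∈ 𝓙) ∧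
      ∃ F ∈ 𝓖, ∀ A ∈ 𝓙, IsRobustKernel k 𝓖 (F.filter fun x => χ x ∈ A) := by
  induction 𝓘 using Finset.strongInduction generalizing 𝓕 with
  | H 𝓘 ih =>
    by_cases hF : ∃ F ∈ 𝓕, ∀ A ∈ 𝓘, IsRobustKernel k 𝓕 (F.filter fun x => χ x ∈ A)
    · exact ⟨𝓘, Subset.rfl, 𝓕, Subset.rfl,
        Nat.le_mul_of_pos_left _ (by positivity), h𝓘, hF⟩
    · push Not at hF
      obtain ⟨A, hA, 𝓗, h𝓗, hcard, hav⟩ := exists_subfamily_avoiding hk 𝓘 𝓕 hχ hF hne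
      have hne' : 𝓗.Nonempty := by
        rw [← card_pos]
        have := hne.card_pos
        exact Nat.pos_of_ne_zero fun h => by rw [h, mul_zero] at hcard; omega
      obtain ⟨𝓙, h𝓙, 𝓖, h𝓖, hcard', htype, hker⟩ :=
        ih (𝓘.erase A) (erase_ssubset hA) 𝓗 hne' (fun F hF => hχ F (h𝓗 hF))
          fun F hF G hG hFG => mem_erase.2 ⟨hav F hF G hG, h𝓘 F (h𝓗 hF) G (h𝓗 hG) hFG⟩
      refine ⟨𝓙, h𝓙.trans (erase_subset _ _), 𝓖, h𝓖.trans h𝓗, ?_, htype, hker⟩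
      calc 𝓕.card ≤ 2 ^ k * k * 𝓗.card := hcard
        _ ≤ 2 ^ k * k * ((2 ^ k * k) ^ (𝓘.erase A).card * 𝓖.card) := by gcongr
        _ = (2 ^ k * k) ^ 𝓘.card * 𝓖.card := by
          rw [← card_erase_add_one hA, pow_succ]; ring

open Finset in
theorem card_filter_mem_of_rainbow {α : Type*} [DecidableEq α] {k : ℕ} {χ : α → Fin k}
    {F : Finset α} (hχ : Set.InjOn χ F) (hF : F.card = k) (A : Finset (Fin k)) :
    (F.filter fun x => χ x ∈ A).card = A.card := by
  have himage : F.image χ = univ := by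
    rw [← card_eq_iff_eq_univ, card_image_of_injOn hχ, hF, Fintype.card_fin]
  rw [← card_image_of_injOn (hχ.mono (coe_subset.2 (filter_subset _ _)))]
  congr 1
  ext a
  simp only [mem_image, mem_filter]
  constructor
  · rintro ⟨x, ⟨-, hx⟩, rfl⟩
    exact hx
  · intro ha
    obtain ⟨x, hx, rfl⟩ := mem_image.1 (himage ▸ mem_univ a)
    exact ⟨x, ⟨hx, ha⟩, rfl⟩

open Finset in
/-- The size bound for a rainbow family whose intersection types are all realised robustly at a
single member. -/
theorem card_le_pow_of_homogeneous {α : Type*} [DecidableEq α] {k s : ℕ}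
    {χ : α → Fin k} (V : Finset α) (hV : V.Nonempty) (L : Finset ℕ)
    (hs : ¬ ConvexSeqIn L (s + 1)) (𝓙 : Finset (Finset (Fin k))) (huniv : univ ∉ 𝓙)
    (𝓖 : Finset (Finset α)) (h𝓖 : ∀ F ∈ 𝓖, F ⊆ V ∧ F.card = k)
    (hχ : ∀ F ∈ 𝓖, Set.InjOn χ F)
    (hL : ∀ F ∈ 𝓖, ∀ G ∈ 𝓖, F ≠ G → (F ∩ G).card ∈ L)
    (htype : ∀ F ∈ 𝓖, ∀ G ∈ 𝓖, F ≠ G → (F ∩ G).image χ ∈ 𝓙)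
    (F : Finset α) (hF : F ∈ 𝓖)
    (hker : ∀ A ∈ 𝓙, IsRobustKernel k 𝓖 (F.filter fun x => χ x ∈ A)) :
    𝓖.card ≤ V.card ^ s := by
  have hcard : ∀ A : Finset (Fin k), (F.filter fun x => χ x ∈ A).card = A.card :=
    card_filter_mem_of_rainbow (hχ F hF) (h𝓖 F hF).2
  have hproper : ∀ A ∈ 𝓙, A.card < k := by
    intro A hA
    have h := card_lt_card (ssubset_univ_iff.2 fun h : A = univ => huniv (h ▸ hA))
    simpa using h
  have key : ∀ A ∈ 𝓙, ∀ B ∈ 𝓙, A ∩ B ∈ 𝓙 ∧ (A ∩ B).card ∈ L := by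
    intro A hA B hB
    obtain ⟨G₁, hG₁, hAG₁, hG₁F⟩ := hker A hA F (h𝓖 F hF).2.le
    obtain ⟨G₂, hG₂, hBG₂, hG₂G₁⟩ := hker B hB G₁ (h𝓖 G₁ hG₁).2.le
    have hinter : G₁ ∩ G₂ = F.filter fun x => χ x ∈ A ∩ B := by
      ext x
      constructor
      · intro hx
        rw [mem_inter] at hx
        have hxB := mem_filter.1 (hG₂G₁ (mem_inter.2 hx.symm))
        have hxA := mem_filter.1 (hG₁F (mem_inter.2 ⟨hx.1, hxB.1⟩))
        exact mem_filter.2 ⟨hxA.1, mem_inter.2 ⟨hxA.2, hxB.2⟩⟩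
      · intro hx
        rw [mem_filter, mem_inter] at hx
        exact mem_inter.2 ⟨hAG₁ (mem_filter.2 ⟨hx.1, hx.2.1⟩), hBG₂ (mem_filter.2 ⟨hx.1, hx.2.2⟩)⟩
    have hlt : (A ∩ B).card < k := (card_le_card inter_subset_left).trans_lt (hproper A hA)
    have hne : G₁ ≠ G₂ := by
      rintro rfl
      have := hcard (A ∩ B)
      rw [← hinter, inter_self, (h𝓖 G₁ hG₁).2] at this
      omega
    have himage : (G₁ ∩ G₂).image χ = A ∩ B := by
      refine eq_of_subset_of_card_le ?_ ?_
      · rw [hinter]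
        exact image_subset_iff.2 fun x hx => (mem_filter.1 hx).2
      · rw [card_image_of_injOn ((hχ G₁ hG₁).mono (coe_subset.2 inter_subset_left)), hinter, hcard]
    refine ⟨himage ▸ htype G₁ hG₁ G₂ hG₂ hne, ?_⟩
    rw [← hcard, ← hinter]
    exact hL G₁ hG₁ G₂ hG₂ hne
  obtain ⟨T, hTs, hT⟩ : ∃ T : Finset (Fin k), T.card ≤ s ∧ ∀ A ∈ 𝓙, ¬ T ⊆ A := by
    by_contra! hcon
    exact hs (convexSeqIn_of_inter_closed 𝓙 L s huniv (fun A hA B hB => (key A hA B hB).1)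
      (fun A hA => inter_self A ▸ (key A hA A hA).2) hcon)
  calc 𝓖.card ≤ (V.powersetCard T.card).card := by
        refine card_le_card_of_injOn (fun G => G.filter fun x => χ x ∈ T) ?_ ?_
        · intro G hG
          exact mem_coe.2 (mem_powersetCard.2 ⟨(filter_subset _ _).trans (h𝓖 G hG).1,
            card_filter_mem_of_rainbow (hχ G hG) (h𝓖 G hG).2 T⟩)
        · intro G hG H hH hGH
          by_contra hne
          refine hT _ (htype G hG H hH hne) ?_
          refine (eq_of_subset_of_card_le (s := (G.filter fun x => χ x ∈ T).image χ)
            (image_subset_iff.2 fun x hx => (mem_filter.1 hx).2) ?_).symm.subset.trans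
            (image_subset_image ?_)
          · rw [card_image_of_injOn ((hχ G hG).mono (coe_subset.2 (filter_subset _ _))),
              card_filter_mem_of_rainbow (hχ G hG) (h𝓖 G hG).2]
          · refine subset_inter (filter_subset _ _) ?_
            exact (show G.filter (fun x => χ x ∈ T) = H.filter (fun x => χ x ∈ T) from hGH) ▸
              filter_subset _ _
    _ ≤ V.card ^ T.card := by
        rw [card_powersetCard]
        exact Nat.choose_le_pow _ _
    _ ≤ V.card ^ s := Nat.pow_le_pow_right hV.card_pos hTs

theorem stmt_2 (k : ℕ) (hk : 1 ≤ k) :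
    ∃ C : ℝ, 0 < C ∧
      ∀ (n s : ℕ) (L : Finset ℕ), L ⊆ Finset.range k →
        ConvexSeqIn L s → ¬ ConvexSeqIn L (s + 1) →
        ∀ 𝓕 : Finset (Finset ℕ),
          (∀ F ∈ 𝓕, F ⊆ Finset.Icc 1 n ∧ F.card = k) →
          (∀ F₁ ∈ 𝓕, ∀ F₂ ∈ 𝓕, F₁ ≠ F₂ → (F₁ ∩ F₂).card ∈ L) →
          (𝓕.card : ℝ) ≤ C * (n : ℝ) ^ s := by
  classical
  let 𝓘 : Finset (Finset (Fin k)) := Finset.univ.erase Finset.univ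
  refine ⟨((k ^ k * (2 ^ k * k) ^ 𝓘.card : ℕ) : ℝ), by positivity, ?_⟩
  intro n s L hLk _ hs 𝓕 h𝓕 hL
  obtain rfl | hne := 𝓕.eq_empty_or_nonempty
  · simp only [Finset.card_empty, Nat.cast_zero]
    positivity
  obtain ⟨χ, hχ⟩ := exists_rainbow_subfamily hk _ 𝓕 h𝓕
  set 𝓗 := 𝓕.filter fun F : Finset ℕ => Set.InjOn χ F with h𝓗
  have hsub : 𝓗 ⊆ 𝓕 := Finset.filter_subset _ _
  have hinj : ∀ F ∈ 𝓗, Set.InjOn χ F := fun F hF => (Finset.mem_filter.1 hF).2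
  have hne' : 𝓗.Nonempty := by
    rw [← Finset.card_pos]
    have := hne.card_pos
    exact Nat.pos_of_ne_zero fun h => by rw [h, mul_zero] at hχ; omega
  obtain ⟨𝓙, h𝓙, 𝓖, h𝓖, hcard, htype, F, hF, hker⟩ :=
    exists_homogeneous_subfamily hk 𝓘 𝓗 hne' hinj fun F hF G hG hFG => by
      refine Finset.mem_erase.2 ⟨fun h => ?_, Finset.mem_univ _⟩
      have hlt := Finset.mem_range.1 (hLk (hL F (hsub hF) G (hsub hG) hFG))
      have := Finset.card_image_le (s := F ∩ G) (f := χ)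
      rw [h, Finset.card_univ, Fintype.card_fin] at this
      omega
  have hV : (Finset.Icc 1 n).Nonempty := by
    obtain ⟨hFV, hFk⟩ := h𝓕 F (hsub (h𝓖 hF))
    exact (Finset.card_pos.1 (by omega)).mono hFV
  have hbound := card_le_pow_of_homogeneous (Finset.Icc 1 n) hV L hs 𝓙
    (fun h => Finset.notMem_erase _ _ (h𝓙 h)) 𝓖 (fun F hF => h𝓕 F (hsub (h𝓖 hF)))
    (fun F hF => hinj F (h𝓖 hF))
    (fun F hF G hG => hL F (hsub (h𝓖 hF)) G (hsub (h𝓖 hG))) htype F hF hker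
  rw [Nat.card_Icc, Nat.add_sub_cancel] at hbound
  have : 𝓕.card ≤ k ^ k * (2 ^ k * k) ^ 𝓘.card * n ^ s :=
    calc 𝓕.card ≤ k ^ k * 𝓗.card := hχ
      _ ≤ k ^ k * ((2 ^ k * k) ^ 𝓘.card * 𝓖.card) := by gcongr
      _ ≤ k ^ k * ((2 ^ k * k) ^ 𝓘.card * n ^ s) := by gcongr
      _ = _ := by ring
  exact_mod_cast this
end

section
/- Let n ≥ k ≥ 1, m ≥ 2, and ℓ ∈ {0,...,k-1} be integers, and let 𝓕 be a family of k-element subsets of {1,...,n}. Then there exists a subfamily 𝓕' ⊆ 𝓕 with |𝓕'| ≥ |𝓕| / (C(k,ℓ) · (8e·2^k·k·m)^{k-ℓ}) such that for every set A ⊆ {1,...,n} with ℓ ≤ |A| ≤ k-1 that is not the kernel of any sunflower with m petals in 𝓕, there exists an element φ(A) ∈ {1,...,n} \ A such that every F ∈ 𝓕' containing A also contains φ(A). Here C(k,ℓ) denotes the binomial coefficient (k choose ℓ). -/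
/-- `A` is the kernel of a sunflower with `m` petals in `𝓕`: there are `m` distinct
members of `𝓕` whose pairwise intersections all equal `A`. -/
def IsSunflowerKernel {α : Type*} [DecidableEq α] (𝓕 : Finset (Finset α)) (m : ℕ)
    (A : Finset α) : Prop :=
  ∃ S ⊆ 𝓕, S.card = m ∧ ∀ F₁ ∈ S, ∀ F₂ ∈ S, F₁ ≠ F₂ → F₁ ∩ F₂ = A

open Finset in
/-- A set that is not the kernel of a sunflower with `m` petals admits a small set meeting every
petal above it. -/
theorem exists_cover_of_not_isSunflowerKernel {α : Type*} [DecidableEq α]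
    {𝓕 : Finset (Finset α)} {k m : ℕ} (h𝓕 : ∀ F ∈ 𝓕, F.card = k) {A : Finset α}
    (hA : ¬ IsSunflowerKernel 𝓕 m A) :
    ∃ C : Finset α, C.card ≤ m * k ∧
      ∀ F ∈ 𝓕, A ⊆ F → A ≠ F → ∃ x ∈ F, x ∉ A ∧ x ∈ C := by
  classical
  let T := 𝓕.powerset.filter fun S =>
    (∀ F ∈ S, A ⊆ F) ∧ ∀ F₁ ∈ S, ∀ F₂ ∈ S, F₁ ≠ F₂ → F₁ ∩ F₂ = A
  obtain ⟨S, hS, hmax⟩ := T.exists_max_image card ⟨∅, by simp [T]⟩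
  simp only [T, mem_filter, mem_powerset] at hS hmax
  obtain ⟨hS𝓕, hSA, hSp⟩ := hS
  have hcard : S.card ≤ m := by
    by_contra! h
    obtain ⟨S', hS', hc⟩ := exists_subset_card_eq h.le
    exact hA ⟨S', hS'.trans hS𝓕, hc, fun F₁ h₁ F₂ h₂ => hSp F₁ (hS' h₁) F₂ (hS' h₂)⟩
  refine ⟨S.biUnion (· \ A), ?_, ?_⟩
  · calc (S.biUnion (· \ A)).card ≤ S.card * k :=
          card_biUnion_le_card_mul _ _ _ fun F hF =>
            (card_le_card sdiff_subset).trans (h𝓕 F (hS𝓕 hF)).le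
      _ ≤ m * k := Nat.mul_le_mul_right _ hcard
  · intro F hF hAF hne
    by_contra! hx
    have hmeet : ∀ G ∈ S, F ∩ G = A := by
      intro G hG
      apply Subset.antisymm
      · intro x hxFG
        rw [mem_inter] at hxFG
        by_contra hxA
        exact hx x hxFG.1 hxA (mem_biUnion.2 ⟨G, hG, mem_sdiff.2 ⟨hxFG.2, hxA⟩⟩)
      · exact subset_inter hAF (hSA G hG)
    have hFS : F ∉ S := fun h => hne (by simpa using (hmeet F h).symm)
    have := hmax (insert F S) ⟨insert_subset hF hS𝓕, ?_, ?_⟩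
    · rw [card_insert_of_notMem hFS] at this
      omega
    · intro G hG
      rcases mem_insert.1 hG with rfl | hG
      exacts [hAF, hSA G hG]
    · intro F₁ h₁ F₂ h₂ h12
      rcases mem_insert.1 h₁ with e₁ | h₁ <;> rcases mem_insert.1 h₂ with e₂ | h₂
      · exact absurd (e₁.trans e₂.symm) h12
      · rw [e₁]
        exact hmeet F₂ h₂
      · rw [e₂, inter_comm]
        exact hmeet F₁ h₁
      · exact hSp F₁ h₁ F₂ h₂ h12

open Finset in
/-- The number of functions to `Fin Q` vanishing on `Z` and nonvanishing on `Y`. -/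
theorem card_filter_eq_zero_and_ne_zero {P : Type*} [Fintype P] [DecidableEq P] (Q : ℕ) [NeZero Q]
    {Z Y : Finset P} (h : Disjoint Z Y) :
    ((univ.filter fun ω : P → Fin Q => (∀ p ∈ Z, ω p = 0) ∧ ∀ p ∈ Y, ω p ≠ 0).card : ℝ) =
      (Q : ℝ) ^ Fintype.card P * (Q : ℝ)⁻¹ ^ Z.card * (1 - (Q : ℝ)⁻¹) ^ Y.card := by
  have hQ : (Q : ℝ) ≠ 0 := Nat.cast_ne_zero.2 (NeZero.ne Q)
  have hset : (univ.filter fun ω : P → Fin Q => (∀ p ∈ Z, ω p = 0) ∧ ∀ p ∈ Y, ω p ≠ 0) =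
      Fintype.piFinset fun p => if p ∈ Z then {0} else if p ∈ Y then {0}ᶜ else univ := by
    ext ω
    simp only [mem_filter, mem_univ, true_and, Fintype.mem_piFinset]
    constructor
    · rintro ⟨h0, h1⟩ p
      split_ifs with hZ hY
      · simpa using h0 p hZ
      · simpa using h1 p hY
      · simp
    · intro hω
      refine ⟨fun p hp => by simpa [hp] using hω p, fun p hp => ?_⟩
      simpa [hp, disjoint_right.1 h hp] using hω p
  have hterm : ∀ p : P,
      (((if p ∈ Z then {0} else if p ∈ Y then {0}ᶜ else univ : Finset (Fin Q)).card : ℕ) : ℝ) =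
        Q * (if p ∈ Z then (Q : ℝ)⁻¹ else 1) * (if p ∈ Y then 1 - (Q : ℝ)⁻¹ else 1) := by
    intro p
    by_cases hZ : p ∈ Z
    · simp [hZ, disjoint_left.1 h hZ, hQ]
    · by_cases hY : p ∈ Y
      · have : 1 ≤ Q := NeZero.one_le
        simp [hZ, hY, card_compl, Nat.cast_sub this, mul_sub, hQ]
      · simp [hZ, hY]
  rw [hset, Fintype.card_piFinset, Nat.cast_prod, prod_congr rfl fun p _ => hterm p,
    prod_mul_distrib, prod_mul_distrib]
  simp [prod_ite_mem, card_univ]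

open Finset in
/-- If every member `F` of a `k`-uniform family comes with a set `U F` of at most `q` forbidden
elements outside `F`, then a large subfamily has the property that no member meets the forbidden
set of another member with which it shares at least `ℓ` elements. -/
theorem exists_subfamily_disjoint_forbidden {α : Type*} [DecidableEq α] {k ℓ q : ℕ}
    (hℓ : ℓ ≤ k) (hq : 0 < q) (𝓕 : Finset (Finset α)) (h𝓕 : ∀ F ∈ 𝓕, F.card = k)
    (U : Finset α → Finset α) (hdisj : ∀ F ∈ 𝓕, Disjoint F (U F))
    (hU : ∀ F ∈ 𝓕, (U F).card ≤ q) :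
    ∃ 𝓕' ⊆ 𝓕, (𝓕.card : ℝ) ≤ 8 * k.choose ℓ * (2 * q) ^ (k - ℓ) * 𝓕'.card ∧
      ∀ F ∈ 𝓕', ∀ G ∈ 𝓕', ℓ ≤ (F ∩ G).card → Disjoint F (U G) := by
  classical
  obtain ⟨Q, hQdef⟩ : ∃ Q, Q = 2 * q := ⟨_, rfl⟩
  have hQ0 : 0 < Q := by omega
  have : NeZero Q := ⟨hQ0.ne'⟩
  have hC0 : 0 < k.choose ℓ := Nat.choose_pos hℓ
  obtain ⟨N, hN⟩ : ∃ N, N = Q ^ ℓ / (2 * k.choose ℓ) + 1 := ⟨_, rfl⟩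
  have hN1 : 1 ≤ N := hN ▸ Nat.le_add_left 1 _
  let V := 𝓕.biUnion id
  have hV : ∀ F ∈ 𝓕, F ⊆ V := fun F hF => subset_biUnion_of_mem id hF
  let Z : Fin N → Finset α → Finset (Fin N × V) := fun i F => {i} ×ˢ F.subtype (· ∈ V)
  have memZ : ∀ i F (p : Fin N × V), p ∈ Z i F ↔ p.1 = i ∧ (p.2 : α) ∈ F := by
    intro i F p
    simp only [Z, mem_product, mem_singleton, mem_subtype]
  have cardZ : ∀ i F, F ⊆ V → (Z i F).card = F.card := by
    intro i F hF
    rw [card_product, card_singleton, one_mul, card_subtype, filter_true_of_mem fun x hx => hF hx]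
  have cardZ_le : ∀ i F, (Z i F).card ≤ F.card := by
    intro i F
    rw [card_product, card_singleton, one_mul, card_subtype]
    exact card_filter_le _ _
  let E : Finset α → Fin N → Finset (Fin N × V → Fin Q) := fun F i => univ.filter fun ω =>
    (∀ p ∈ Z i F, ω p = 0) ∧ (∀ p ∈ Z i (U F), ω p ≠ 0) ∧
      ∀ j ≠ i, ∀ D ∈ F.powersetCard ℓ, ∃ p ∈ Z j D, ω p ≠ 0
  have memE : ∀ F i ω, ω ∈ E F i ↔ (∀ p ∈ Z i F, ω p = 0) ∧ (∀ p ∈ Z i (U F), ω p ≠ 0) ∧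
      ∀ j ≠ i, ∀ D ∈ F.powersetCard ℓ, ∃ p ∈ Z j D, ω p ≠ 0 := fun F i ω => by
    rw [mem_filter, and_iff_right (mem_univ ω)]
  have hE_eq : ∀ ω F G i j, ω ∈ E F i → ω ∈ E G j → ℓ ≤ (F ∩ G).card → i = j := by
    intro ω F G i j hF hG hFG
    by_contra hij
    rw [memE] at hF hG
    obtain ⟨D, hD, hDc⟩ := exists_subset_card_eq hFG
    obtain ⟨p, hp, hp0⟩ := hF.2.2 j (Ne.symm hij) D
      (mem_powersetCard.2 ⟨hD.trans inter_subset_left, hDc⟩)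
    rw [memZ] at hp
    exact hp0 (hG.1 p ((memZ _ _ _).2 ⟨hp.1, inter_subset_right (hD hp.2)⟩))
  set M : ℝ := (Q : ℝ) ^ Fintype.card (Fin N × V) with hM
  have hQR : (0 : ℝ) < Q := by exact_mod_cast hQ0
  have hM0 : 0 < M := by positivity
  have hpow : (1 / 2 : ℝ) ≤ (1 - (Q : ℝ)⁻¹) ^ q := by
    have hq' : (0 : ℝ) < q := by exact_mod_cast hq
    have h1 : (Q : ℝ)⁻¹ ≤ 1 := inv_le_one_of_one_le₀ (by exact_mod_cast hQ0)
    have := one_add_mul_le_pow (a := -(Q : ℝ)⁻¹) (by linarith) q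
    have h2 : (q : ℝ) * (Q : ℝ)⁻¹ = 1 / 2 := by
      rw [hQdef]; push_cast; field_simp
    rw [← sub_eq_add_neg] at this
    linarith
  have hNle : ((N : ℝ) - 1) * k.choose ℓ * (Q : ℝ)⁻¹ ^ ℓ ≤ 1 / 2 := by
    have h1 : (N - 1) * (2 * k.choose ℓ) ≤ Q ^ ℓ := by
      rw [hN, Nat.add_sub_cancel]
      exact Nat.div_mul_le_self _ _
    have h2 : ((N : ℝ) - 1) * (2 * k.choose ℓ) ≤ (Q : ℝ) ^ ℓ := by
      have : ((N - 1 : ℕ) : ℝ) = (N : ℝ) - 1 := by rw [Nat.cast_sub hN1, Nat.cast_one]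
      rw [← this]
      exact_mod_cast h1
    rw [inv_pow, ← div_eq_mul_inv, div_le_iff₀ (by positivity)]
    linarith
  have hNge : (Q : ℝ) ^ ℓ ≤ N * (2 * k.choose ℓ) := by
    have h1 : Q ^ ℓ ≤ N * (2 * k.choose ℓ) := by
      rw [hN]
      rw [mul_comm]
      exact (Nat.lt_mul_div_succ _ (by positivity)).le
    exact_mod_cast h1
  have hcardE : ∀ F ∈ 𝓕, ∀ i, M * (Q : ℝ)⁻¹ ^ k / 4 ≤ (E F i).card := by
    intro F hF i
    have hdZ : ∀ j, Disjoint (Z j F) (Z i (U F)) := by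
      intro j
      rw [disjoint_left]
      intro p hp hp'
      rw [memZ] at hp hp'
      exact disjoint_left.1 (hdisj F hF) hp.2 hp'.2
    let B := univ.filter fun ω : Fin N × V → Fin Q =>
      (∀ p ∈ Z i F, ω p = 0) ∧ ∀ p ∈ Z i (U F), ω p ≠ 0
    let X : Fin N × Finset α → Finset (Fin N × V → Fin Q) := fun jD => univ.filter fun ω =>
      (∀ p ∈ Z i F ∪ Z jD.1 jD.2, ω p = 0) ∧ ∀ p ∈ Z i (U F), ω p ≠ 0
    let I := (univ.erase i) ×ˢ F.powersetCard ℓ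
    set b : ℝ := M * (Q : ℝ)⁻¹ ^ k * (1 - (Q : ℝ)⁻¹) ^ (Z i (U F)).card with hb
    have hBcard : (B.card : ℝ) = b := by
      rw [card_filter_eq_zero_and_ne_zero Q (hdZ i), cardZ i F (hV F hF), h𝓕 F hF]
    have hXcard : ∀ jD ∈ I, ((X jD).card : ℝ) = b * (Q : ℝ)⁻¹ ^ ℓ := by
      rintro ⟨j, D⟩ hjD
      simp only [I, mem_product, mem_erase, mem_univ, and_true, mem_powersetCard] at hjD
      obtain ⟨hj, hDF, hDc⟩ := hjD
      have hsub : Z j D ⊆ Z j F := fun p hp => by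
        rw [memZ] at hp ⊢
        exact ⟨hp.1, hDF hp.2⟩
      have hd : Disjoint (Z i F) (Z j D) := by
        rw [disjoint_left]
        intro p hp hp'
        rw [memZ] at hp hp'
        exact hj (hp'.1.symm.trans hp.1)
      rw [card_filter_eq_zero_and_ne_zero Q
        (disjoint_union_left.2 ⟨hdZ i, (hdZ j).mono_left hsub⟩), card_union_of_disjoint hd,
        cardZ i F (hV F hF), cardZ j D (hDF.trans (hV F hF)), h𝓕 F hF, hDc, hb, pow_add]
      ring
    have hBsub : B ⊆ E F i ∪ I.biUnion X := by
      intro ω hω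
      simp only [B, mem_filter, mem_univ, true_and] at hω
      rw [mem_union, or_iff_not_imp_right]
      intro hnot
      rw [memE]
      refine ⟨hω.1, hω.2, fun j hj D hD => ?_⟩
      by_contra! hzero
      refine hnot (mem_biUnion.2 ⟨(j, D), mem_product.2 ⟨by simpa using hj, hD⟩, ?_⟩)
      simp only [X, mem_filter, mem_univ, true_and]
      refine ⟨fun p hp => ?_, hω.2⟩
      rcases mem_union.1 hp with hp | hp
      exacts [hω.1 p hp, hzero p hp]
    have hcount : (B.card : ℝ) ≤ (E F i).card + ∑ jD ∈ I, ((X jD).card : ℝ) := by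
      have h1 : B.card ≤ (E F i).card + ∑ jD ∈ I, (X jD).card :=
        (card_le_card hBsub).trans ((card_union_le _ _).trans
          (Nat.add_le_add_left card_biUnion_le _))
      exact_mod_cast h1
    have hIcard : (I.card : ℝ) = ((N : ℝ) - 1) * k.choose ℓ := by
      rw [card_product, card_erase_of_mem (mem_univ i), card_univ, Fintype.card_fin,
        card_powersetCard, h𝓕 F hF, Nat.cast_mul, Nat.cast_sub hN1, Nat.cast_one]
    rw [sum_congr rfl hXcard, sum_const, nsmul_eq_mul, hIcard, hBcard] at hcount
    have hQ1 : (Q : ℝ)⁻¹ ≤ 1 := inv_le_one_of_one_le₀ (by exact_mod_cast hQ0)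
    have hQinv : (0 : ℝ) < (Q : ℝ)⁻¹ := by positivity
    have hbge : M * (Q : ℝ)⁻¹ ^ k * (1 / 2) ≤ b := by
      rw [hb]
      refine mul_le_mul_of_nonneg_left (hpow.trans ?_) (by positivity)
      exact pow_le_pow_of_le_one (by linarith) (by linarith)
        ((cardZ_le i (U F)).trans (hU F hF))
    have hb0 : 0 ≤ b := le_trans (by positivity) hbge
    have := mul_le_mul_of_nonneg_left hNle hb0
    linarith
  let R : (Fin N × V → Fin Q) → Finset (Finset α) := fun ω => 𝓕.filter fun F => ∃ i, ω ∈ E F i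
  have hbelow : ∀ F ∈ 𝓕, M * ((Q : ℝ) ^ (k - ℓ))⁻¹ / (8 * k.choose ℓ) ≤
      ((univ.filter fun ω => ∃ i, ω ∈ E F i).card : ℝ) := by
    intro F hF
    have hU' : (univ.filter fun ω => ∃ i, ω ∈ E F i) = univ.biUnion (E F) := by
      ext ω
      simp
    rw [hU', card_biUnion, Nat.cast_sum]
    · calc M * ((Q : ℝ) ^ (k - ℓ))⁻¹ / (8 * k.choose ℓ)
          = M * (Q : ℝ)⁻¹ ^ k / 4 * ((Q : ℝ) ^ ℓ / (2 * k.choose ℓ)) := by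
            have hk : (Q : ℝ) ^ k = (Q : ℝ) ^ (k - ℓ) * (Q : ℝ) ^ ℓ := by
              rw [← pow_add, Nat.sub_add_cancel hℓ]
            have hC : (k.choose ℓ : ℝ) ≠ 0 := by positivity
            rw [inv_pow, hk]
            field_simp
            norm_num
        _ ≤ M * (Q : ℝ)⁻¹ ^ k / 4 * N := by
            refine mul_le_mul_of_nonneg_left ?_ (by positivity)
            rw [div_le_iff₀ (by positivity)]
            exact hNge
        _ = ∑ i : Fin N, M * (Q : ℝ)⁻¹ ^ k / 4 := by
            simp [mul_comm]
        _ ≤ ∑ i, ((E F i).card : ℝ) := sum_le_sum fun i _ => hcardE F hF i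
    · intro i _ j _ hij
      refine disjoint_left.2 fun ω hi hj => ?_
      exact hij (hE_eq ω F F i j hi hj (by rw [inter_self, h𝓕 F hF]; exact hℓ))
  have hdouble : ∑ ω, (R ω).card = ∑ F ∈ 𝓕, (univ.filter fun ω => ∃ i, ω ∈ E F i).card :=
    sum_card_bipartiteAbove_eq_sum_card_bipartiteBelow fun ω F => ∃ i, ω ∈ E F i
  obtain ⟨ω, -, hω⟩ : ∃ ω ∈ (univ : Finset (Fin N × V → Fin Q)),
      (𝓕.card : ℝ) * (((Q : ℝ) ^ (k - ℓ))⁻¹ / (8 * k.choose ℓ)) ≤ (R ω).card := by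
    apply exists_le_of_sum_le univ_nonempty
    rw [← Nat.cast_sum, hdouble, Nat.cast_sum]
    refine le_trans (le_of_eq ?_) (sum_le_sum hbelow)
    rw [sum_const, sum_const, card_univ, Fintype.card_fun, Fintype.card_fin, nsmul_eq_mul,
      nsmul_eq_mul, Nat.cast_pow, hM]
    ring
  refine ⟨R ω, filter_subset _ _, ?_, ?_⟩
  · have hcast : (2 * (q : ℝ)) = Q := by rw [hQdef]; push_cast; ring
    have hC : (0 : ℝ) < k.choose ℓ := by exact_mod_cast hC0
    rw [hcast]
    have hc : (0 : ℝ) < 8 * k.choose ℓ * (Q : ℝ) ^ (k - ℓ) := by positivity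
    rwa [inv_div_left, ← div_eq_mul_inv, div_le_iff₀' hc] at hω
  · intro F hF G hG hFG
    obtain ⟨hF𝓕, i, hi⟩ := mem_filter.1 hF
    obtain ⟨-, j, hj⟩ := mem_filter.1 hG
    obtain rfl := hE_eq ω F G i j hi hj hFG
    rw [memE] at hi hj
    rw [disjoint_left]
    intro x hxF hxU
    exact hj.2.1 (i, ⟨x, hV F hF𝓕 hxF⟩) ((memZ _ _ _).2 ⟨rfl, hxU⟩)
      (hi.1 _ ((memZ _ _ _).2 ⟨rfl, hxF⟩))

theorem stmt_5 (n k m ℓ : ℕ) (hnk : k ≤ n) (hk : 1 ≤ k) (hm : 2 ≤ m) (hℓ : ℓ ≤ k - 1)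
    (𝓕 : Finset (Finset ℕ)) (h𝓕 : ∀ F ∈ 𝓕, F ⊆ Finset.Icc 1 n ∧ F.card = k) :
    ∃ 𝓕' ⊆ 𝓕,
      (𝓕.card : ℝ) /
          ((Nat.choose k ℓ : ℝ) * (8 * Real.exp 1 * 2 ^ k * k * m) ^ (k - ℓ))
        ≤ (𝓕'.card : ℝ) ∧
      ∀ A ⊆ Finset.Icc 1 n, ℓ ≤ A.card → A.card ≤ k - 1 →
        ¬ IsSunflowerKernel 𝓕 m A →
        ∃ x ∈ Finset.Icc 1 n, x ∉ A ∧ ∀ F ∈ 𝓕', A ⊆ F → x ∈ F := by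
  have hcover : ∀ A : Finset ℕ, ∃ C : Finset ℕ, C.card ≤ m * k ∧ (¬ IsSunflowerKernel 𝓕 m A →
      ∀ F ∈ 𝓕, A ⊆ F → A ≠ F → ∃ x ∈ F, x ∉ A ∧ x ∈ C) := by
    intro A
    by_cases hA : IsSunflowerKernel 𝓕 m A
    · exact ⟨∅, by simp, fun h => absurd hA h⟩
    · obtain ⟨C, hC, hC'⟩ := exists_cover_of_not_isSunflowerKernel (fun F hF => (h𝓕 F hF).2) hA
      exact ⟨C, hC, fun _ => hC'⟩
  choose C hCcard hC using hcover
  obtain ⟨𝓕', hsub, hcard, hdisj⟩ := exists_subfamily_disjoint_forbidden (k := k) (ℓ := ℓ)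
    (q := 2 ^ k * (m * k)) (by omega) (Nat.mul_pos (by positivity) (Nat.mul_pos (by omega) hk)) 𝓕 (fun F hF => (h𝓕 F hF).2)
    (fun F => F.powerset.biUnion C \ F) (fun F _ => Finset.disjoint_sdiff) (by
      intro F hF
      refine (Finset.card_le_card Finset.sdiff_subset).trans ?_
      have := Finset.card_biUnion_le_card_mul F.powerset C _ fun A _ => hCcard A
      rwa [Finset.card_powerset, (h𝓕 F hF).2] at this)
  refine ⟨𝓕', hsub, ?_, ?_⟩
  · have hC0 : (0 : ℝ) < k.choose ℓ := by exact_mod_cast Nat.choose_pos (by omega : ℓ ≤ k)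
    have hk0 : (0 : ℝ) < k := by exact_mod_cast hk
    have hm0 : (0 : ℝ) < m := by exact_mod_cast (by omega : 0 < m)
    have he : (2 : ℝ) ≤ Real.exp 1 := by linarith [Real.add_one_le_exp (1 : ℝ)]
    rw [div_le_iff₀ (mul_pos hC0 (by positivity))]
    refine hcard.trans ?_
    have h8 : (8 : ℝ) ≤ 8 ^ (k - ℓ) := le_self_pow₀ (by norm_num) (by omega)
    have hbase : (8 : ℝ) * (2 * (2 ^ k * (m * k))) ≤ 8 * Real.exp 1 * 2 ^ k * k * m := by
      have := mul_le_mul_of_nonneg_right he (by positivity : (0 : ℝ) ≤ 8 * (2 ^ k * (m * k)))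
      linarith
    have hpow : (8 : ℝ) * (2 * (2 ^ k * (m * k))) ^ (k - ℓ) ≤
        (8 * Real.exp 1 * 2 ^ k * k * m) ^ (k - ℓ) := by
      refine le_trans ?_ (pow_le_pow_left₀ (by positivity) hbase _)
      rw [mul_pow (8 : ℝ)]
      exact mul_le_mul_of_nonneg_right h8 (by positivity)
    have := mul_le_mul_of_nonneg_left hpow (by positivity : (0 : ℝ) ≤ k.choose ℓ * 𝓕'.card)
    push_cast
    linarith
  · intro A hAn hℓA hAk hA
    by_cases hex : ∃ F ∈ 𝓕', A ⊆ F
    · obtain ⟨F₀, hF₀, hAF₀⟩ := hex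
      have hne : A ≠ F₀ := by
        rintro rfl
        have := (h𝓕 A (hsub hF₀)).2
        omega
      obtain ⟨x, hxF₀, hxA, hxC⟩ := hC A hA F₀ (hsub hF₀) hAF₀ hne
      refine ⟨x, (h𝓕 F₀ (hsub hF₀)).1 hxF₀, hxA, fun F hF hAF => ?_⟩
      have hd := hdisj F₀ hF₀ F hF
        (hℓA.trans (Finset.card_le_card (Finset.subset_inter hAF₀ hAF)))
      by_contra hxF
      exact Finset.disjoint_left.1 hd hxF₀ (Finset.mem_sdiff.2
        ⟨Finset.mem_biUnion.2 ⟨A, Finset.mem_powerset.2 hAF, hxC⟩, hxF⟩)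
    · push Not at hex
      obtain ⟨x, hx, hxA⟩ := Finset.exists_mem_notMem_of_card_lt_card
        (s := A) (t := Finset.Icc 1 n) (by rw [Nat.card_Icc]; omega)
      exact ⟨x, hx, hxA, fun F hF hAF => absurd hAF (hex F hF)⟩
end

section
/- Let p be a positive integer, let k be a multiple of p, and let m ≥ 2. Suppose 𝓕 is a finite family of k-element sets such that there do not exist m members of 𝓕 with pairwise intersection sizes all not divisible by p. Then there exists a subfamily 𝓕' ⊆ 𝓕 with |𝓕'| ≥ c(k) · m^{-k/p} · |𝓕| for some constant c(k) > 0 depending only on k, such that for all distinct F_1, F_2 ∈ 𝓕', the intersection size |F_1 ∩ F_2| is divisible by p. -/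
open Finset

/-- In a finite vertex set where every closed neighbourhood has at most `Δ` vertices, some
independent set carries at least a `1 / Δ` proportion of any given weight. -/
theorem exists_independent_sum_le {τ : Type*} (r : τ → τ → Prop) (hrefl : ∀ u, r u u)
    (hsymm : ∀ u v, r u v → r v u) (w : τ → ℕ) (Δ : ℕ) (V : Finset τ) [DecidableRel r]
    (hΔ : ∀ u ∈ V, (V.filter (r u)).card ≤ Δ) :
    ∃ I ⊆ V, (∀ u ∈ I, ∀ v ∈ I, u ≠ v → ¬ r u v) ∧ ∑ u ∈ V, w u ≤ Δ * ∑ u ∈ I, w u := by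
  classical
  induction V using Finset.strongInduction with
  | H V ih =>
    rcases V.eq_empty_or_nonempty with rfl | hV
    · exact ⟨∅, by simp, by simp, by simp⟩
    · obtain ⟨u, hu, hmax⟩ := V.exists_max_image w hV
      have hlt : V.filter (fun x => ¬ r u x) ⊂ V :=
        Finset.filter_ssubset.2 ⟨u, hu, by simpa using hrefl u⟩
      obtain ⟨I, hIV, hI, hsum⟩ := ih _ hlt fun x hx =>
        (card_le_card (filter_subset_filter _ hlt.subset)).trans (hΔ x (hlt.subset hx))
      have huI : ∀ x ∈ I, ¬ r u x := fun x hx => (mem_filter.1 (hIV hx)).2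
      refine ⟨insert u I, insert_subset hu (hIV.trans hlt.subset), ?_, ?_⟩
      · intro x hx y hy hxy
        rcases mem_insert.1 hx with rfl | hxI <;> rcases mem_insert.1 hy with rfl | hyI
        · exact absurd rfl hxy
        · exact huI y hyI
        · exact fun h => huI x hxI (hsymm _ _ h)
        · exact hI x hxI y hyI hxy
      · rw [sum_insert fun h => huI u h (hrefl u), mul_add,
          ← sum_filter_add_sum_filter_not V (r u) w]
        refine add_le_add ?_ hsum
        calc ∑ x ∈ V with r u x, w x ≤ (V.filter (r u)).card • w u :=
              sum_le_card_nsmul _ _ _ fun x hx => hmax x (mem_filter.1 hx).1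
          _ ≤ Δ * w u := Nat.mul_le_mul_right _ (hΔ u hu)

section Agreement

variable {σ ι α : Type*} [DecidableEq α] (v : σ → ι → α)

/-- The coordinates in `R` at which the tuples attached to `x` and `y` coincide. -/
def agreement (R : Finset ι) (x y : σ) : Finset ι := R.filter fun i => v x i = v y i

/-- The members of `X` whose tuple coincides with that of `x` on all of `B`. -/
def agreeingOn (X : Finset σ) (B : Finset ι) (x : σ) : Finset σ :=
  X.filter fun y => ∀ i ∈ B, v y i = v x i

/-- No `m` members of `X` have pairwise agreement sizes within `R` all nonzero modulo `p`. -/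
def AgreementCliqueFree (p m : ℕ) (R : Finset ι) (X : Finset σ) : Prop :=
  ¬ ∃ S ⊆ X, S.card = m ∧ ∀ x ∈ S, ∀ y ∈ S, x ≠ y → ¬ p ∣ (agreement v R x y).card

variable {v}

theorem agreement_comm (R : Finset ι) (x y : σ) : agreement v R x y = agreement v R y x := by
  simp only [agreement, eq_comm]

theorem AgreementCliqueFree.exists_dominating {p m : ℕ} {R : Finset ι} {X : Finset σ}
    (hX : AgreementCliqueFree v p m R X) (hpR : p ∣ R.card) {Y : Finset σ} (hY : Y ⊆ X) :
    ∃ S ⊆ Y, S.card ≤ m ∧ ∀ y ∈ Y, ∃ s ∈ S, p ∣ (agreement v R s y).card := by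
  have : DecidableEq σ := Classical.decEq σ
  let cliques := Y.powerset.filter fun S =>
    ∀ x ∈ S, ∀ y ∈ S, x ≠ y → ¬ p ∣ (agreement v R x y).card
  have hne : cliques.Nonempty := ⟨∅, by simp [cliques]⟩
  obtain ⟨S, hS, hmax⟩ := cliques.exists_max_image card hne
  obtain ⟨hSY, hSc⟩ := mem_filter.1 hS
  rw [mem_powerset] at hSY
  refine ⟨S, hSY, ?_, ?_⟩
  · by_contra! h
    obtain ⟨T, hTS, hT⟩ := exists_subset_card_eq h.le
    exact hX ⟨T, hTS.trans (hSY.trans hY), hT,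
      fun x hx y hy => hSc x (hTS hx) y (hTS hy)⟩
  · intro y hy
    by_contra! h
    have hyS : y ∉ S := fun hyS => h y hyS (by simpa [agreement] using hpR)
    have hins : insert y S ∈ cliques := by
      refine mem_filter.2 ⟨mem_powerset.2 (insert_subset hy hSY), ?_⟩
      intro a ha b hb hab
      rcases mem_insert.1 ha with rfl | haS <;> rcases mem_insert.1 hb with rfl | hbS
      · exact absurd rfl hab
      · rw [agreement_comm]; exact h b hbS
      · exact h a haS
      · exact hSc a haS b hbS hab
    have := hmax _ hins
    rw [card_insert_of_notMem hyS] at this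
    omega

/-- Few tuples through a given value at `i` have all their `p`-subtuples of small degree. -/
theorem AgreementCliqueFree.card_light_le {p m K w : ℕ} {R : Finset ι} {X : Finset σ}
    (hX : AgreementCliqueFree v p m R X) (hpR : p ∣ R.card) (hm : 0 < m) {i : ι} (hi : i ∈ R)
    {Y : Finset σ} (hY : Y ⊆ X) (hYi : ∀ x ∈ Y, ∀ y ∈ Y, v x i = v y i)
    (hlight : ∀ x ∈ Y, ∀ B ∈ R.powersetCard p, K * m * (agreeingOn v X B x).card ≤ w) :
    K * Y.card ≤ (R.powersetCard p).card * w := by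
  classical
  obtain ⟨S, hSY, hSm, hS⟩ := hX.exists_dominating hpR hY
  have hcover : Y ⊆ S.biUnion fun s => (R.powersetCard p).biUnion fun B => agreeingOn v X B s := by
    intro y hy
    obtain ⟨s, hs, hdvd⟩ := hS y hy
    have hpos : 0 < (agreement v R s y).card :=
      card_pos.2 ⟨i, mem_filter.2 ⟨hi, hYi s (hSY hs) y hy⟩⟩
    obtain ⟨B, hB, hBc⟩ := exists_subset_card_eq (Nat.le_of_dvd hpos hdvd)
    refine mem_biUnion.2 ⟨s, hs, mem_biUnion.2 ⟨B, mem_powersetCard.2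
      ⟨hB.trans (filter_subset _ _), hBc⟩, mem_filter.2 ⟨hY hy, fun j hj => ?_⟩⟩⟩
    exact (mem_filter.1 (hB hj)).2.symm
  have hle : Y.card ≤ ∑ s ∈ S, ∑ B ∈ R.powersetCard p, (agreeingOn v X B s).card :=
    (card_le_card hcover).trans
      (card_biUnion_le.trans (sum_le_sum fun s _ => card_biUnion_le))
  refine Nat.le_of_mul_le_mul_left ?_ hm
  calc m * (K * Y.card)
      ≤ m * (K * ∑ s ∈ S, ∑ B ∈ R.powersetCard p, (agreeingOn v X B s).card) := by gcongr
    _ = ∑ s ∈ S, ∑ B ∈ R.powersetCard p, K * m * (agreeingOn v X B s).card := by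
        simp only [mul_sum]
        exact sum_congr rfl fun s _ => sum_congr rfl fun B _ => by ring
    _ ≤ ∑ s ∈ S, ∑ B ∈ R.powersetCard p, w :=
        sum_le_sum fun s hs => sum_le_sum fun B hB => hlight s (hSY hs) B hB
    _ = S.card * ((R.powersetCard p).card * w) := by simp
    _ ≤ m * ((R.powersetCard p).card * w) := by gcongr

/-- If `B`-subtuples have large degree relative to each of their entries, a large subfamily has
`B`-subtuples which are pairwise equal or disjoint. -/
theorem exists_agreement_all_or_none {L : ℕ} {X Y : Finset σ} (hY : Y ⊆ X) (B : Finset ι)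
    (hB : B.Nonempty)
    (hheavy : ∀ x ∈ Y, ∀ i ∈ B,
      (agreeingOn v X {i} x).card ≤ L * (agreeingOn v X B x).card) :
    ∃ Z ⊆ Y, Y.card ≤ B.card * L * Z.card ∧
      ∀ x ∈ Z, ∀ y ∈ Z, (∀ i ∈ B, v x i = v y i) ∨ ∀ i ∈ B, v x i ≠ v y i := by
  classical
  let π : σ → B → α := fun x i => v x i
  have hπ : ∀ x y, π x = π y ↔ ∀ i ∈ B, v x i = v y i := fun x y => by
    simp [π, funext_iff]
  let r : (B → α) → (B → α) → Prop := fun a b => ∃ i, a i = b i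
  have hdeg : ∀ u ∈ Y.image π, ((Y.image π).filter (r u)).card ≤ B.card * L := by
    intro u hu
    obtain ⟨x, hx, rfl⟩ := mem_image.1 hu
    have hsub : (Y.image π).filter (r (π x)) ⊆
        B.attach.biUnion fun i => (Y.image π).filter fun b => b i = π x i := by
      intro b hb
      obtain ⟨hb, i, hi⟩ := mem_filter.1 hb
      exact mem_biUnion.2 ⟨i, mem_attach _ _, mem_filter.2 ⟨hb, hi.symm⟩⟩
    refine (card_le_card hsub).trans ((card_biUnion_le_card_mul _ _ L fun i _ => ?_).trans
      (by rw [card_attach]))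
    set Q := (Y.image π).filter fun b => b i = π x i with hQ
    have hWpos : 0 < (agreeingOn v X {i.1} x).card :=
      card_pos.2 ⟨x, mem_filter.2 ⟨hY hx, by simp⟩⟩
    refine Nat.le_of_mul_le_mul_right ?_ hWpos
    have hfib : ∑ b ∈ Q, (X.filter fun y => π y = b).card ≤ (agreeingOn v X {i.1} x).card := by
      rw [← card_biUnion]
      · refine card_le_card fun y hy => ?_
        obtain ⟨b, hb, hy⟩ := mem_biUnion.1 hy
        obtain ⟨hyX, rfl⟩ := mem_filter.1 hy
        exact mem_filter.2 ⟨hyX, by simpa [π] using (mem_filter.1 hb).2⟩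
      · intro b _ b' _ hbb'
        refine disjoint_left.2 fun y hy hy' => hbb' ?_
        rw [← (mem_filter.1 hy).2, (mem_filter.1 hy').2]
    calc Q.card * (agreeingOn v X {i.1} x).card
        = ∑ b ∈ Q, (agreeingOn v X {i.1} x).card := by simp
      _ ≤ ∑ b ∈ Q, L * (X.filter fun y => π y = b).card := by
          refine sum_le_sum fun b hb => ?_
          obtain ⟨hb, hbi⟩ := mem_filter.1 hb
          obtain ⟨z, hz, rfl⟩ := mem_image.1 hb
          have hzx : v z i = v x i := hbi
          have h := hheavy z hz i i.2
          simpa only [agreeingOn, mem_singleton, forall_eq, hzx, hπ] using h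
      _ ≤ L * (agreeingOn v X {i.1} x).card := by
          rw [← mul_sum]
          gcongr
  obtain ⟨i₀, hi₀⟩ := hB
  obtain ⟨I, hI, hind, hsum⟩ := exists_independent_sum_le r (fun u => ⟨⟨i₀, hi₀⟩, rfl⟩)
    (fun a b ⟨i, hi⟩ => ⟨i, hi.symm⟩) (fun u => (Y.filter fun y => π y = u).card)
    (B.card * L) (Y.image π) hdeg
  refine ⟨Y.filter fun y => π y ∈ I, filter_subset _ _, ?_, ?_⟩
  · rw [← card_eq_sum_card_image] at hsum
    refine hsum.trans (Nat.mul_le_mul_left _ ?_)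
    rw [card_eq_sum_card_fiberwise (s := Y.filter fun y => π y ∈ I) (f := π) (t := I)
      fun y hy => (mem_filter.1 hy).2]
    refine sum_le_sum fun u hu => card_le_card fun y hy => ?_
    obtain ⟨hyY, rfl⟩ := mem_filter.1 hy
    exact mem_filter.2 ⟨mem_filter.2 ⟨hyY, hu⟩, rfl⟩
  · intro x hx y hy
    by_cases h : π x = π y
    · exact Or.inl ((hπ x y).1 h)
    · exact Or.inr fun i hi hxy =>
        hind _ (mem_filter.1 hx).2 _ (mem_filter.1 hy).2 h ⟨⟨i, hi⟩, hxy⟩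

/-- The loss factor, up to `m`, in making one block of `p` out of `d * p` coordinates rigid. -/
def blockConst (p d : ℕ) : ℕ := 4 * p * (d * p) * (d * p).choose p ^ 2

theorem AgreementCliqueFree.exists_block {p m d : ℕ} {R : Finset ι} {X : Finset σ}
    (hX : AgreementCliqueFree v p m R X) (hp : 0 < p) (hm : 0 < m) (hd : 0 < d)
    (hR : R.card = d * p) :
    ∃ B ⊆ R, B.card = p ∧ ∃ Z ⊆ X, X.card ≤ blockConst p d * m * Z.card ∧
      ∀ x ∈ Z, ∀ y ∈ Z, (∀ i ∈ B, v x i = v y i) ∨ ∀ i ∈ B, v x i ≠ v y i := by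
  classical
  set P := R.powersetCard p with hP
  have hPcard : P.card = (d * p).choose p := by rw [hP, card_powersetCard, hR]
  have hPne : P.Nonempty := by
    rw [hP, powersetCard_nonempty, hR]
    exact Nat.le_mul_of_pos_left p hd
  set K := 2 * R.card * P.card with hK
  have hRpos : 0 < R.card := by rw [hR]; positivity
  have hPpos : 0 < P.card := hPne.card_pos
  let light : ι → Finset σ := fun i => X.filter fun x =>
    ∀ B ∈ P, K * m * (agreeingOn v X B x).card ≤ (agreeingOn v X {i} x).card
  have hlight : ∀ i ∈ R, K * (light i).card ≤ P.card * X.card := by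
    intro i hi
    have hmaps : ∀ Y ⊆ X, Y.card =
        ∑ a ∈ X.image (v · i), (Y.filter fun x => v x i = a).card := fun Y hY =>
      card_eq_sum_card_fiberwise fun x hx => mem_image_of_mem (v · i) (hY hx)
    rw [hmaps (light i) (filter_subset _ _), hmaps X subset_rfl, mul_sum, mul_sum]
    refine sum_le_sum fun a _ => hX.card_light_le (hR ▸ dvd_mul_left p d) hm hi
      ((filter_subset _ _).trans (filter_subset _ _)) ?_ ?_
    · intro x hx y hy
      rw [(mem_filter.1 hx).2, (mem_filter.1 hy).2]
    · intro x hx B hB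
      obtain ⟨hxl, rfl⟩ := mem_filter.1 hx
      simpa [agreeingOn] using (mem_filter.1 hxl).2 B hB
  have hbad : 2 * (R.biUnion light).card ≤ X.card := by
    refine Nat.le_of_mul_le_mul_left ?_ (Nat.mul_pos hRpos hPpos)
    calc R.card * P.card * (2 * (R.biUnion light).card)
        = K * (R.biUnion light).card := by rw [hK]; ring
      _ ≤ K * ∑ i ∈ R, (light i).card := by gcongr; exact card_biUnion_le
      _ = ∑ i ∈ R, K * (light i).card := mul_sum _ _ _
      _ ≤ ∑ i ∈ R, P.card * X.card := sum_le_sum hlight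
      _ = R.card * P.card * X.card := by simp [mul_assoc]
  set G := X \ R.biUnion light with hG
  have hGX : G ⊆ X := sdiff_subset
  have hGcard : X.card ≤ 2 * G.card := by
    have := le_card_sdiff (R.biUnion light) X
    rw [← hG] at this
    omega
  choose β hβP hβ using fun x => P.exists_max_image (fun B => (agreeingOn v X B x).card) hPne
  obtain ⟨B, hBP, hBcard⟩ : ∃ B ∈ P, G.card ≤ P.card * (G.filter fun x => β x = B).card := by
    by_contra! h
    have hlt := sum_lt_sum_of_nonempty hPne h
    rw [← mul_sum, ← card_eq_sum_card_fiberwise fun x _ => hβP x, sum_const, smul_eq_mul] at hlt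
    exact lt_irrefl _ hlt
  obtain ⟨hBR, hBp⟩ := mem_powersetCard.1 hBP
  obtain ⟨Z, hZ, hZcard, hZB⟩ := exists_agreement_all_or_none (v := v) (L := K * m) (X := X)
    (Y := G.filter fun x => β x = B) ((filter_subset _ _).trans hGX) B
    (card_pos.1 (hBp ▸ hp)) (by
      intro x hx i hi
      obtain ⟨hxG, rfl⟩ := mem_filter.1 hx
      obtain ⟨hxX, hxbad⟩ := mem_sdiff.1 hxG
      by_contra! h
      refine hxbad (mem_biUnion.2 ⟨i, hBR hi, mem_filter.2 ⟨hxX, fun B' hB' => ?_⟩⟩)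
      exact (Nat.mul_le_mul_left _ (hβ x B' hB')).trans h.le)
  refine ⟨B, hBR, hBp, Z, hZ.trans ((filter_subset _ _).trans hGX), ?_, hZB⟩
  calc X.card ≤ 2 * G.card := hGcard
    _ ≤ 2 * (P.card * (B.card * (K * m) * Z.card)) := by
        gcongr
        exact hBcard.trans (by gcongr)
    _ = blockConst p d * m * Z.card := by
        rw [hK, hBp, hR, hPcard, blockConst]; ring

theorem AgreementCliqueFree.exists_independent {p m d : ℕ} {R : Finset ι} {X : Finset σ}
    (hX : AgreementCliqueFree v p m R X) (hp : 0 < p) (hm : 0 < m) (hR : R.card = d * p) :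
    ∃ Y ⊆ X, X.card ≤ (∏ j ∈ range d, blockConst p (j + 1)) * m ^ d * Y.card ∧
      ∀ x ∈ Y, ∀ y ∈ Y, p ∣ (agreement v R x y).card := by
  classical
  induction d generalizing R X with
  | zero =>
    obtain rfl : R = ∅ := by simpa using hR
    exact ⟨X, subset_rfl, by simp, by simp [agreement]⟩
  | succ d ih =>
    obtain ⟨B, hBR, hBp, Z, hZX, hZcard, hZ⟩ := hX.exists_block hp hm d.succ_pos hR
    have hdvd : ∀ x ∈ Z, ∀ y ∈ Z,
        (p ∣ (agreement v R x y).card ↔ p ∣ (agreement v (R \ B) x y).card) := by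
      intro x hx y hy
      have hsplit : (agreement v R x y).card =
          (agreement v (R \ B) x y).card + (agreement v B x y).card := by
        rw [agreement, agreement, agreement, ← card_union_of_disjoint
          (disjoint_filter_filter sdiff_disjoint), ← filter_union, sdiff_union_of_subset hBR]
      have hB : p ∣ (agreement v B x y).card := by
        rcases hZ x hx y hy with h | h
        · rw [agreement, filter_true_of_mem h, hBp]
        · rw [agreement, filter_false_of_mem h]; simp
      rw [hsplit, Nat.dvd_add_left hB]
    have hfree : AgreementCliqueFree v p m (R \ B) Z := fun ⟨S, hS, hSm, hSc⟩ =>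
      hX ⟨S, hS.trans hZX, hSm, fun x hx y hy hxy h =>
        hSc x hx y hy hxy ((hdvd x (hS hx) y (hS hy)).1 h)⟩
    obtain ⟨Y, hYZ, hYcard, hY⟩ := ih hfree (by
      rw [card_sdiff_of_subset hBR, hR, hBp, Nat.succ_mul, Nat.add_sub_cancel])
    refine ⟨Y, hYZ.trans hZX, ?_, fun x hx y hy =>
      (hdvd x (hYZ hx) y (hYZ hy)).2 (hY x hx y hy)⟩
    calc X.card ≤ blockConst p (d + 1) * m * Z.card := hZcard
      _ ≤ blockConst p (d + 1) * m *
          ((∏ j ∈ range d, blockConst p (j + 1)) * m ^ d * Y.card) := by gcongr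
      _ = _ := by rw [prod_range_succ]; ring

end Agreement

/-- Some colouring with `k` colours makes a `k ^ (-k)` proportion of a `k`-uniform family
rainbow. -/
theorem exists_coloring_card_le_rainbow {α : Type*} [DecidableEq α] (k : ℕ)
    (𝓕 : Finset (Finset α)) (h𝓕 : ∀ F ∈ 𝓕, F.card = k) :
    ∃ χ : α → ℕ, ∃ 𝓖 ⊆ 𝓕, 𝓕.card ≤ k ^ k * 𝓖.card ∧
      ∀ F ∈ 𝓖, Set.InjOn χ F ∧ ∀ a ∈ F, χ a < k := by
  classical
  let S := 𝓕.biUnion id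
  have hS : ∀ F ∈ 𝓕, F ⊆ S := fun F hF => subset_biUnion_of_mem id hF
  let rainbow : (S → Fin k) → Finset α → Prop := fun f F =>
    ∀ a b : S, a.1 ∈ F → b.1 ∈ F → f a = f b → a = b
  have hcount : ∀ F ∈ 𝓕, Fintype.card (S → Fin k) ≤
      k ^ k * (univ.filter fun f => rainbow f F).card := by
    intro F hF
    let e := F.equivFinOfCardEq (h𝓕 F hF)
    let Φ : (S → Fin k) → (Fin k → Fin k) × (S → Fin k) := fun f =>
      (fun j => f ⟨(e.symm j).1, hS F hF (e.symm j).2⟩,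
        fun s => if h : s.1 ∈ F then e ⟨s.1, h⟩ else f s)
    have hΦ : Function.Injective Φ := by
      intro f g hfg
      obtain ⟨h1, h2⟩ := Prod.ext_iff.1 hfg
      funext s
      by_cases hs : s.1 ∈ F
      · simpa [Φ] using congrFun h1 (e ⟨s.1, hs⟩)
      · simpa [Φ, hs] using congrFun h2 s
    have := card_le_card_of_injOn (s := univ)
      (t := (univ : Finset (Fin k → Fin k)) ×ˢ univ.filter fun f => rainbow f F) Φ
      (fun f _ => by
        refine mem_product.2 ⟨mem_univ _, mem_filter.2 ⟨mem_univ _, fun a b ha hb hab => ?_⟩⟩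
        simp only [Φ, ha, hb, dite_true] at hab
        exact Subtype.ext (Subtype.mk.inj (e.injective hab))) hΦ.injOn
    simpa [card_product] using this
  have hne : Nonempty (S → Fin k) := by
    refine ⟨fun s => ⟨0, ?_⟩⟩
    obtain ⟨F, hF, hs⟩ := mem_biUnion.1 s.2
    exact h𝓕 F hF ▸ card_pos.2 ⟨_, hs⟩
  obtain ⟨f, hf⟩ : ∃ f : S → Fin k, 𝓕.card ≤ k ^ k * (𝓕.filter (rainbow f)).card := by
    by_contra! h
    have hlt := sum_lt_sum_of_nonempty (univ_nonempty (α := S → Fin k)) fun f _ => h f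
    have hswap := sum_card_bipartiteAbove_eq_sum_card_bipartiteBelow
      (s := (univ : Finset (S → Fin k))) (t := 𝓕) rainbow
    simp only [bipartiteAbove, bipartiteBelow] at hswap
    rw [← mul_sum, hswap, mul_sum] at hlt
    have hle := sum_le_sum hcount
    simp only [sum_const, smul_eq_mul, card_univ] at hlt hle
    rw [mul_comm] at hle
    exact absurd hle (not_le.2 hlt)
  refine ⟨fun a => if h : a ∈ S then f ⟨a, h⟩ else 0, 𝓕.filter (rainbow f),
    filter_subset _ _, hf, fun F hF => ?_⟩
  obtain ⟨hF, hrain⟩ := mem_filter.1 hF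
  refine ⟨fun a ha b hb hab => ?_, fun a ha => ?_⟩
  · have ha' := hS F hF ha
    have hb' := hS F hF hb
    simp only [ha', hb', dite_true] at hab
    exact congrArg Subtype.val (hrain ⟨a, ha'⟩ ⟨b, hb'⟩ ha hb (Fin.ext hab))
  · simp [hS F hF ha]

/-- For rainbow sets, the size of the intersection counts the colours on which they agree. -/
theorem card_agreement_rainbow {α : Type*} [DecidableEq α] {k : ℕ} {χ : α → ℕ} {F G : Finset α}
    (hF : F.card = k) (hFχ : Set.InjOn χ F) (hFk : ∀ a ∈ F, χ a < k) (hGχ : Set.InjOn χ G) :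
    (agreement (fun (H : Finset α) i => H.filter fun a => χ a = i) (range k) F G).card =
      (F ∩ G).card := by
  symm
  refine card_bij (fun a _ => χ a) ?_ ?_ ?_
  · intro a ha
    obtain ⟨haF, haG⟩ := mem_inter.1 ha
    refine mem_filter.2 ⟨mem_range.2 (hFk a haF), ?_⟩
    ext b
    simp only [mem_filter]
    constructor
    · rintro ⟨hb, hab⟩
      exact ⟨hFχ hb haF hab ▸ haG, hab⟩
    · rintro ⟨hb, hab⟩
      exact ⟨hGχ hb haG hab ▸ haF, hab⟩
  · intro a ha b hb hab
    exact hFχ (mem_inter.1 ha).1 (mem_inter.1 hb).1 hab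
  · intro i hi
    obtain ⟨hi, hFG⟩ := mem_filter.1 hi
    have himage : F.image χ = range k := eq_of_subset_of_card_le
      (fun j hj => by
        obtain ⟨a, ha, rfl⟩ := mem_image.1 hj
        exact mem_range.2 (hFk a ha))
      (by rw [card_image_of_injOn hFχ, hF, card_range])
    obtain ⟨a, ha, rfl⟩ := mem_image.1 (himage ▸ hi)
    have haG : a ∈ G.filter fun b => χ b = χ a :=
      (Finset.ext_iff.1 hFG a).1 (mem_filter.2 ⟨ha, rfl⟩)
    exact ⟨a, mem_inter.2 ⟨ha, (mem_filter.1 haG).1⟩, rfl⟩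

theorem stmt_10 (p k : ℕ) (hp : 1 ≤ p) (hpk : p ∣ k) :
    ∃ c : ℝ, 0 < c ∧
      ∀ (α : Type) [DecidableEq α] (m : ℕ), 2 ≤ m →
        ∀ 𝓕 : Finset (Finset α), (∀ F ∈ 𝓕, F.card = k) →
          (¬ ∃ S ⊆ 𝓕, S.card = m ∧
            ∀ F₁ ∈ S, ∀ F₂ ∈ S, F₁ ≠ F₂ → ¬ p ∣ (F₁ ∩ F₂).card) →
          ∃ 𝓕' ⊆ 𝓕,
            c * ((m : ℝ))⁻¹ ^ (k / p) * (𝓕.card : ℝ) ≤ (𝓕'.card : ℝ) ∧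
            ∀ F₁ ∈ 𝓕', ∀ F₂ ∈ 𝓕', F₁ ≠ F₂ → p ∣ (F₁ ∩ F₂).card := by
  set C := k ^ k * ∏ j ∈ range (k / p), blockConst p (j + 1) with hC
  have hCpos : 0 < C := by
    refine Nat.mul_pos Nat.pow_self_pos (prod_pos fun j _ => ?_)
    have : 0 < ((j + 1) * p).choose p := Nat.choose_pos (Nat.le_mul_of_pos_left p j.succ_pos)
    unfold blockConst
    positivity
  refine ⟨(C : ℝ)⁻¹, by positivity, fun α _ m hm 𝓕 h𝓕 hfree => ?_⟩
  obtain ⟨χ, 𝓖, h𝓖, h𝓖card, hχ⟩ := exists_coloring_card_le_rainbow k 𝓕 h𝓕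
  let v : Finset α → ℕ → Finset α := fun H i => H.filter fun a => χ a = i
  have hinter : ∀ F ∈ 𝓖, ∀ G ∈ 𝓖, (agreement v (range k) F G).card = (F ∩ G).card :=
    fun F hF G hG => card_agreement_rainbow (h𝓕 F (h𝓖 hF)) (hχ F hF).1 (hχ F hF).2 (hχ G hG).1
  have hfree' : AgreementCliqueFree v p m (range k) 𝓖 := fun ⟨S, hS, hSm, hSc⟩ =>
    hfree ⟨S, hS.trans h𝓖, hSm, fun F hF G hG hFG =>
      hinter F (hS hF) G (hS hG) ▸ hSc F hF G hG hFG⟩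
  obtain ⟨Y, hY, hYcard, hYdvd⟩ := hfree'.exists_independent hp (by omega) (d := k / p)
    (by rw [card_range, Nat.div_mul_cancel hpk])
  refine ⟨Y, hY.trans h𝓖, ?_, fun F hF G hG _ =>
    hinter F (hY hF) G (hY hG) ▸ hYdvd F hF G hG⟩
  have hnat : 𝓕.card ≤ C * m ^ (k / p) * Y.card :=
    calc 𝓕.card ≤ k ^ k * 𝓖.card := h𝓖card
      _ ≤ k ^ k * ((∏ j ∈ range (k / p), blockConst p (j + 1)) * m ^ (k / p) * Y.card) := by
          gcongr
      _ = C * m ^ (k / p) * Y.card := by rw [hC]; ring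
  have hmpos : (0 : ℝ) < m := by exact_mod_cast (by omega : 0 < m)
  have hreal : (𝓕.card : ℝ) ≤ C * (m : ℝ) ^ (k / p) * Y.card := by exact_mod_cast hnat
  have hCR : (0 : ℝ) < C := by exact_mod_cast hCpos
  rw [inv_pow, ← mul_inv, inv_mul_le_iff₀ (by positivity)]
  exact hreal
end
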